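/- Wendland's C² function is strictly positive definite on ℝ²: for every shape parameter c > 0, every n ≥ 1, every tuple of pairwise distinct points x₁,…,xₙ ∈ ℝ², and every nonzero vector b ∈ ℝⁿ, one has ∑_{i=1}^{n} ∑_{j=1}^{n} b_i b_j (1 − c‖x_i − x_j‖₂)₊⁴ (4c‖x_i − x_j‖₂ + 1) > 0, where (t)₊ = max(t, 0) denotes the truncated power function. Equivalently, the matrix with these entries is positive definite whenever the nodes are pairwise distinct. -/

import Mathlib

namespace Wend

open MeasureTheory Set

lemma pos_of {f f' : ℝ → ℝ} {a b : ℝ} (hd : ∀ t, HasDerivAt f (f' t) t) (h0 : 0 ≤ f a)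
    (hf' : ∀ t ∈ Ioo a b, 0 < f' t) : ∀ t ∈ Ioc a b, 0 < f t := by
  intro t ht
  have hm : StrictMonoOn f (Icc a b) := by
    apply strictMonoOn_of_deriv_pos (convex_Icc a b)
    · exact fun x _ => (hd x).continuousAt.continuousWithinAt
    · intro x hx
      rw [interior_Icc] at hx
      rw [(hd x).deriv]
      exact hf' x hx
  have := hm (left_mem_Icc.2 (ht.1.le.trans ht.2)) ⟨ht.1.le, ht.2⟩ ht.1
  linarith

/-- numerator of the cosine transform -/
noncomputable def P (w : ℝ) : ℝ :=
  4 * w ^ 2 - w ^ 2 * Real.cos w + 9 * w * Real.sin w - 24 * (1 - Real.cos w)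
noncomputable def P1 (w : ℝ) : ℝ :=
  8 * w + 7 * w * Real.cos w + w ^ 2 * Real.sin w - 15 * Real.sin w
noncomputable def P2 (w : ℝ) : ℝ :=
  8 - 8 * Real.cos w - 5 * w * Real.sin w + w ^ 2 * Real.cos w
noncomputable def P3 (w : ℝ) : ℝ :=
  3 * Real.sin w - 3 * w * Real.cos w - w ^ 2 * Real.sin w
noncomputable def P5 (w : ℝ) : ℝ := Real.sin w - w * Real.cos w

lemma hP (w : ℝ) : HasDerivAt P (P1 w) w := by
  have hs := Real.hasDerivAt_sin w
  have hc := Real.hasDerivAt_cos w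
  have hi := hasDerivAt_id w
  have := ((((hi.pow 2).const_mul 4).sub ((hi.pow 2).mul hc)).add ((hi.const_mul 9).mul hs)).sub
    ((hc.const_sub 1).const_mul 24)
  refine this.congr_deriv ?_
  simp [P1]; ring

lemma hP1 (w : ℝ) : HasDerivAt P1 (P2 w) w := by
  have hs := Real.hasDerivAt_sin w
  have hc := Real.hasDerivAt_cos w
  have hi := hasDerivAt_id w
  have := (((hi.const_mul 8).add ((hi.const_mul 7).mul hc)).add ((hi.pow 2).mul hs)).sub
    (hs.const_mul 15)
  refine this.congr_deriv ?_
  simp [P2]; ring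

lemma hP2 (w : ℝ) : HasDerivAt P2 (P3 w) w := by
  have hs := Real.hasDerivAt_sin w
  have hc := Real.hasDerivAt_cos w
  have hi := hasDerivAt_id w
  have := (((hc.const_mul 8).const_sub 8).sub ((hi.const_mul 5).mul hs)).add ((hi.pow 2).mul hc)
  refine this.congr_deriv ?_
  simp [P3]; ring

lemma hP3 (w : ℝ) : HasDerivAt P3 (w * P5 w) w := by
  have hs := Real.hasDerivAt_sin w
  have hc := Real.hasDerivAt_cos w
  have hi := hasDerivAt_id w
  have := ((hs.const_mul 3).sub ((hi.const_mul 3).mul hc)).sub ((hi.pow 2).mul hs)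
  refine this.congr_deriv ?_
  simp [P5]; ring

lemma hP5 (w : ℝ) : HasDerivAt P5 (w * Real.sin w) w := by
  have hs := Real.hasDerivAt_sin w
  have hc := Real.hasDerivAt_cos w
  have hi := hasDerivAt_id w
  have := hs.sub (hi.mul hc)
  refine this.congr_deriv ?_
  simp

lemma P_pos {w : ℝ} (hw : 0 < w) : 0 < P w := by
  have hpi := Real.pi_gt_three
  have hpi' := Real.pi_lt_four
  have h5 : ∀ t ∈ Ioc 0 Real.pi, 0 < P5 t :=
    pos_of hP5 (by simp [P5]) fun t ht => mul_pos ht.1 (Real.sin_pos_of_pos_of_lt_pi ht.1 ht.2)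
  have h3 : ∀ t ∈ Ioc 0 Real.pi, 0 < P3 t :=
    pos_of hP3 (by simp [P3]) fun t ht => mul_pos ht.1 (h5 t ⟨ht.1, ht.2.le⟩)
  have h3' : ∀ t ∈ Ioo 0 (3 * Real.pi / 2), 0 < P3 t := by
    intro t ht
    rcases le_or_gt t Real.pi with h | h
    · exact h3 t ⟨ht.1, h⟩
    · have hs : Real.sin t < 0 := by
        have := Real.sin_pos_of_pos_of_lt_pi (x := t - Real.pi) (by linarith) (by linarith [ht.2])
        rw [Real.sin_sub_pi] at this; linarith
      have hc : Real.cos t < 0 :=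
        Real.cos_neg_of_pi_div_two_lt_of_lt (by linarith) (by linarith [ht.2])
      unfold P3
      nlinarith [mul_pos ht.1 (neg_pos.2 hc), mul_pos (neg_pos.2 hs) (by nlinarith : 0 < t^2 - 3)]
  have h2 : ∀ t ∈ Ioc 0 (3 * Real.pi / 2), 0 < P2 t := pos_of hP2 (by simp [P2]) h3'
  have h2' : ∀ t ∈ Ioo 0 (2 * Real.pi), 0 < P2 t := by
    intro t ht
    rcases le_or_gt t (3 * Real.pi / 2) with h | h
    · exact h2 t ⟨ht.1, h⟩
    · have hs : Real.sin t < 0 := by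
        have := Real.sin_pos_of_pos_of_lt_pi (x := t - Real.pi) (by linarith) (by linarith [ht.2])
        rw [Real.sin_sub_pi] at this; linarith
      have hc : 0 < Real.cos t := by
        rw [← Real.cos_sub_two_pi]
        exact Real.cos_pos_of_mem_Ioo ⟨by linarith, by linarith [ht.2]⟩
      unfold P2
      nlinarith [mul_pos ht.1 (neg_pos.2 hs), mul_pos hc (by nlinarith : 0 < t^2 - 8)]
  have h1 : ∀ t ∈ Ioc 0 (2 * Real.pi), 0 < P1 t := pos_of hP1 (by simp [P1]) h2'
  have h0 : ∀ t ∈ Ioc 0 (2 * Real.pi), 0 < P t :=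
    pos_of hP (by simp [P]) fun t ht => h1 t ⟨ht.1, ht.2.le⟩
  rcases le_or_gt w (2 * Real.pi) with h | h
  · exact h0 w ⟨hw, h⟩
  · have hc := Real.cos_le_one w
    have hc' := Real.neg_one_le_cos w
    have hs := Real.neg_one_le_sin w
    unfold P
    nlinarith [mul_nonneg (sq_nonneg w) (sub_nonneg.2 hc), mul_nonneg hw.le (by linarith : 0 ≤ Real.sin w + 1)]

lemma P_le (w : ℝ) (hw : 1 ≤ |w|) : |P w| ≤ 62 * w ^ 2 := by
  have hc := Real.cos_le_one w
  have hc' := Real.neg_one_le_cos w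
  have hs : |w * Real.sin w| ≤ |w| := by
    rw [abs_mul]; exact mul_le_of_le_one_right (abs_nonneg _) (Real.abs_sin_le_one w)
  have h2 := sq_abs w
  obtain ⟨hs1, hs2⟩ := abs_le.1 hs
  unfold P
  rw [abs_le]
  constructor <;>
  nlinarith [mul_nonneg (sq_nonneg w) (sub_nonneg.2 hc), mul_nonneg (sq_nonneg w) (by linarith : 0 ≤ Real.cos w + 1)]

lemma P_neg (w : ℝ) : P (-w) = P w := by simp [P]

/-- one-dimensional profile -/
noncomputable def g (t : ℝ) : ℝ := (max (1 - |t|) 0) ^ 3 * (1 + 3 * |t| - 24 * |t| ^ 2)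

lemma g_cont : Continuous g := by unfold g; fun_prop

lemma g_neg (t : ℝ) : g (-t) = g t := by simp [g]

lemma g_zero {t : ℝ} (ht : 1 ≤ |t|) : g t = 0 := by
  simp [g, max_eq_right (by linarith : 1 - |t| ≤ 0)]

lemma g_supp : HasCompactSupport g := by
  apply HasCompactSupport.intro (isCompact_Icc (a := (-1:ℝ)) (b := 1))
  intro t ht
  apply g_zero
  by_contra h
  exact ht (abs_le.1 (not_le.1 h).le)

lemma g_cos_integral {w : ℝ} (hw : w ≠ 0) :
    ∫ t in (0:ℝ)..1, g t * Real.cos (w * t) = 120 * P w / w ^ 6 := by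
  have e : ∫ t in (0:ℝ)..1, g t * Real.cos (w * t) =
      ∫ t in (0:ℝ)..1, ((1 - t) ^ 3 * (1 + 3 * t - 24 * t ^ 2)) * Real.cos (w * t) := by
    apply intervalIntegral.integral_congr
    intro t ht
    rw [uIcc_of_le zero_le_one] at ht
    simp only [g, abs_of_nonneg ht.1, max_eq_left (by linarith [ht.2] : (0:ℝ) ≤ 1 - t)]
  rw [e, intervalIntegral.integral_eq_sub_of_hasDerivAt (f := fun t =>
    ((1 - t) ^ 3 * (1 + 3 * t - 24 * t ^ 2)) * Real.sin (w * t) / w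
    + (-60 * (t - 4 * t ^ 2 + 5 * t ^ 3 - 2 * t ^ 4)) * Real.cos (w * t) / w ^ 2
    - (-60 * (1 - 8 * t + 15 * t ^ 2 - 8 * t ^ 3)) * Real.sin (w * t) / w ^ 3
    - (-60 * (-8 + 30 * t - 24 * t ^ 2)) * Real.cos (w * t) / w ^ 4
    + (-60 * (30 - 48 * t)) * Real.sin (w * t) / w ^ 5
    + 2880 * Real.cos (w * t) / w ^ 6)]
  · simp [P]; field_simp; ring
  · intro t _
    have hi := hasDerivAt_id t
    have hwt : HasDerivAt (fun t => w * t) w t := by simpa using hi.const_mul w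
    have hs := hwt.sin
    have hc := hwt.cos
    have := ((((((((hi.const_sub 1).pow 3).mul (((hi.const_mul 3).const_add 1).sub
      ((hi.pow 2).const_mul 24))).mul hs).div_const w).add
      ((((((hi.sub ((hi.pow 2).const_mul 4)).add ((hi.pow 3).const_mul 5)).sub
        ((hi.pow 4).const_mul 2)).const_mul (-60)).mul hc).div_const (w ^ 2))).sub
      ((((((hi.const_mul 8).const_sub 1).add ((hi.pow 2).const_mul 15)).sub
        ((hi.pow 3).const_mul 8)).const_mul (-60)).mul hs |>.div_const (w ^ 3))).sub
      (((((hi.const_mul 30).const_add (-8)).sub ((hi.pow 2).const_mul 24)).const_mul (-60)).mul hc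
        |>.div_const (w ^ 4))).add
      ((((hi.const_mul 48).const_sub 30).const_mul (-60)).mul hs |>.div_const (w ^ 5)) |>.add
      ((hc.const_mul 2880).div_const (w ^ 6))
    refine this.congr_deriv ?_
    simp
    field_simp
    ring
  · apply Continuous.intervalIntegrable; fun_prop

/-- Fourier transform of `g` -/
noncomputable def K (ξ : ℝ) : ℝ := 2 * ∫ t in (0:ℝ)..1, g t * Real.cos (2 * Real.pi * ξ * t)

open FourierTransform

lemma fourier_g (ξ : ℝ) : 𝓕 (fun t => (g t : ℂ)) ξ = (K ξ : ℂ) := by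
  rw [Real.fourier_real_eq_integral_exp_smul]
  set h : ℝ → ℂ := fun v => Complex.exp (↑(-2 * Real.pi * v * ξ) * Complex.I) • (g v : ℂ) with hh
  have hcont : Continuous h := by
    have := g_cont
    simp only [hh]; fun_prop
  have h1 : ∫ v, h v = ∫ v in (-1:ℝ)..1, h v := by
    rw [intervalIntegral.integral_of_le (by norm_num)]
    symm
    apply setIntegral_eq_integral_of_forall_compl_eq_zero
    intro t ht
    have : g t = 0 := by
      apply g_zero
      by_contra hlt
      have := abs_lt.1 (not_le.1 hlt)
      exact ht ⟨this.1, this.2.le⟩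
    simp [hh, this]
  have h2 : ∫ v in (-1:ℝ)..0, h v = ∫ v in (0:ℝ)..1, h (-v) := by
    rw [intervalIntegral.integral_comp_neg]; simp
  rw [h1, ← intervalIntegral.integral_add_adjacent_intervals (b := 0)
    (hcont.intervalIntegrable _ _) (hcont.intervalIntegrable _ _), h2,
    ← intervalIntegral.integral_add (f := fun v => h (-v)) ((hcont.comp continuous_neg).intervalIntegrable _ _)
      (hcont.intervalIntegrable _ _), K, ← intervalIntegral.integral_const_mul,
      ← intervalIntegral.integral_ofReal]
  congr 1
  ext v
  simp only [hh, g_neg, smul_eq_mul]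
  push_cast
  rw [Complex.cos]
  ring_nf

lemma K_eq {ξ : ℝ} (h : ξ ≠ 0) : K ξ = 240 * P (2 * Real.pi * ξ) / (2 * Real.pi * ξ) ^ 6 := by
  rw [K, g_cos_integral (by have := Real.pi_ne_zero; positivity)]; ring

lemma K_pos {ξ : ℝ} (h : 0 < ξ) : 0 < K ξ := by
  rw [K_eq h.ne']
  have : 0 < 2 * Real.pi * ξ := by have := Real.pi_pos; positivity
  have := P_pos this
  positivity

lemma K_neg (ξ : ℝ) : K (-ξ) = K ξ := by simp [K]

lemma K_cont : Continuous K := by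
  have h := g_cont
  unfold K
  apply Continuous.mul continuous_const
  apply intervalIntegral.continuous_parametric_intervalIntegral_of_continuous'
  fun_prop

lemma K_nonneg (ξ : ℝ) : 0 ≤ K ξ := by
  have hpos : ∀ ξ, ξ ≠ 0 → 0 < K ξ := by
    intro ξ h
    rcases lt_or_gt_of_ne h with h | h
    · rw [← K_neg]; exact K_pos (by linarith)
    · exact K_pos h
  have hcl : IsClosed {ξ | 0 ≤ K ξ} := isClosed_le continuous_const K_cont
  have hd : Dense {ξ : ℝ | 0 ≤ K ξ} := (dense_compl_singleton (0:ℝ)).mono fun ξ h => (hpos ξ h).le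
  have := hd.closure_eq
  rw [hcl.closure_eq] at this
  exact this.symm.subset (mem_univ ξ)

lemma K_int : Integrable K := by
  obtain ⟨C, hC⟩ := (isCompact_Icc (a := (-1:ℝ)) (b := 1)).exists_bound_of_continuousOn
    K_cont.continuousOn
  have hC0 : 0 ≤ C := (norm_nonneg _).trans (hC 0 (by simp))
  refine Integrable.mono' (integrable_inv_one_add_sq.const_mul (2 * C + 2 * 240 * 62))
    K_cont.aestronglyMeasurable (Filter.Eventually.of_forall fun ξ => ?_)
  rw [← div_eq_mul_inv, le_div_iff₀ (by positivity)]
  rcases le_or_gt |ξ| 1 with h | h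
  · have h1 := hC ξ (abs_le.1 h)
    have : ξ ^ 2 ≤ 1 := by rw [← sq_abs]; nlinarith [abs_nonneg ξ]
    nlinarith [norm_nonneg (K ξ)]
  · have hξ : ξ ≠ 0 := by rintro rfl; simp at h; linarith
    have hsq : 1 ≤ ξ ^ 2 := by rw [← sq_abs]; nlinarith
    set w := 2 * Real.pi * ξ with hw
    have hpi := Real.pi_gt_three
    have hwx : ξ ^ 2 ≤ w ^ 2 := by
      rw [hw, mul_pow]
      exact le_mul_of_one_le_left (sq_nonneg _) (by nlinarith)
    have hw1 : 1 ≤ |w| := by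
      rw [hw, abs_mul, abs_of_pos (by positivity)]; nlinarith
    have := P_le w hw1
    have hw0 : 0 < w ^ 2 := by linarith
    have hK : ‖K ξ‖ ≤ 240 * 62 / (w ^ 2) ^ 2 := by
      rw [K_eq hξ, ← hw, Real.norm_eq_abs, abs_div, abs_mul, abs_of_pos (by positivity : (0:ℝ) < 240),
        abs_of_pos (by rw [show w ^ 6 = (w ^ 2) ^ 3 by ring]; positivity : 0 < w ^ 6), show w ^ 6 = (w ^ 2) ^ 3 by ring,
        div_le_div_iff₀ (by positivity) (by positivity)]
      nlinarith [mul_le_mul_of_nonneg_right this (by positivity : 0 ≤ (w^2)^2)]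
    have h3 : 240 * 62 / (w ^ 2) ^ 2 ≤ 240 * 62 / ξ ^ 2 := by
      apply div_le_div_of_nonneg_left (by norm_num) (by positivity)
      nlinarith
    have h4 : ‖K ξ‖ * ξ ^ 2 ≤ 240 * 62 := by
      rw [← le_div_iff₀ (by positivity)]; exact hK.trans h3
    nlinarith [norm_nonneg (K ξ)]

lemma g_inv (t : ℝ) : (g t : ℂ) = ∫ ξ, Complex.exp (↑(2 * Real.pi * ξ * t) * Complex.I) * (K ξ : ℂ) := by
  have hF : 𝓕 (fun t => (g t : ℂ)) = fun ξ => (K ξ : ℂ) := funext fourier_g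
  have hc : Continuous fun t => (g t : ℂ) := Complex.continuous_ofReal.comp g_cont
  have hi : Integrable fun t => (g t : ℂ) := (g_cont.integrable_of_hasCompactSupport g_supp).ofReal
  have := hc.fourierInv_fourier_eq hi (by rw [hF]; exact K_int.ofReal)
  rw [hF] at this
  rw [← congrFun this t, Real.fourierInv_eq']
  simp [mul_comm t, mul_assoc]

lemma q_eq {n : ℕ} (b : Fin n → ℝ) (s : Fin n → ℝ) :
    ∑ i, ∑ j, b i * b j * g (s i - s j) =
      ∫ ξ, K ξ * ‖∑ i, (b i : ℂ) * Complex.exp (↑(2 * Real.pi * ξ * s i) * Complex.I)‖ ^ 2 := by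
  apply Complex.ofReal_injective
  rw [← integral_complex_ofReal]
  push_cast
  simp_rw [g_inv, ← integral_const_mul]
  have hint : ∀ a : ℂ, ∀ t : ℝ, Integrable fun ξ : ℝ =>
      a * (Complex.exp (↑(2 * Real.pi * ξ * t) * Complex.I) * (K ξ : ℂ)) := by
    intro a t
    apply Integrable.const_mul
    refine K_int.ofReal.bdd_mul (c := 1) (by fun_prop) ?_
    refine Filter.Eventually.of_forall fun ξ => ?_
    rw [Complex.norm_exp_ofReal_mul_I]
  simp_rw [← integral_finsetSum _ (fun j _ => hint _ _)]
  rw [← integral_finsetSum _ (fun i _ => integrable_finsetSum _ fun j _ => hint _ _)]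
  congr 1
  ext ξ
  rw [← Complex.mul_conj', map_sum, Finset.sum_mul_sum, Finset.mul_sum]
  refine Finset.sum_congr rfl fun i _ => ?_
  rw [Finset.mul_sum]
  refine Finset.sum_congr rfl fun j _ => ?_
  have e1 : (starRingEnd ℂ) (2 * Real.pi * ξ * s j * Complex.I) =
      ↑(2 * Real.pi * ξ * s j) * -Complex.I := by
    rw [show (2 * Real.pi * ξ * s j * Complex.I : ℂ) = ↑(2 * Real.pi * ξ * s j) * Complex.I by
      push_cast; ring, map_mul, Complex.conj_ofReal, Complex.conj_I]
  rw [map_mul, Complex.conj_ofReal, ← Complex.exp_conj, e1,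
    show (↑(2 * Real.pi * ξ * (s i - s j)) * Complex.I : ℂ) = ↑(2 * Real.pi * ξ * s i) * Complex.I
      + ↑(2 * Real.pi * ξ * s j) * -Complex.I by push_cast; ring, Complex.exp_add]
  push_cast
  ring

lemma q_nonneg {n : ℕ} (b : Fin n → ℝ) (s : Fin n → ℝ) :
    0 ≤ ∑ i, ∑ j, b i * b j * g (s i - s j) := by
  rw [q_eq]
  exact integral_nonneg fun ξ => mul_nonneg (K_nonneg ξ) (by positivity)

lemma q_pos {n : ℕ} (b : Fin n → ℝ) (s : Fin n → ℝ) (ξ : ℝ) (hξ : 0 < ξ)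
    (h : ∑ i, (b i : ℂ) * Complex.exp (↑(2 * Real.pi * ξ * s i) * Complex.I) ≠ 0) :
    0 < ∑ i, ∑ j, b i * b j * g (s i - s j) := by
  rw [q_eq]
  have hK := K_cont
  refine integral_pos_of_integrable_nonneg_nonzero (x := ξ) (by fun_prop) ?_
    (fun ξ => mul_nonneg (K_nonneg ξ) (by positivity)) ?_
  · refine K_int.mul_bdd (c := (∑ i, |b i|) ^ 2) (by fun_prop) ?_
    refine Filter.Eventually.of_forall fun ξ => ?_
    rw [norm_pow, norm_norm]
    gcongr
    refine (norm_sum_le _ _).trans (le_of_eq ?_)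
    refine Finset.sum_congr rfl fun i _ => ?_
    rw [norm_mul, Complex.norm_exp_ofReal_mul_I]
    simp
  · have := K_pos hξ
    have := norm_pos_iff.2 h
    positivity


lemma inner_int (a : ℝ) : Integrable (fun v : ℝ => (√(a - v ^ 2))⁻¹) ∧
    ∫ v : ℝ, (√(a - v ^ 2))⁻¹ = if 0 < a then Real.pi else 0 := by
  split_ifs with ha
  · set d := √a with hd
    have hd0 : 0 < d := Real.sqrt_pos.2 ha
    have had : a = d ^ 2 := (Real.sq_sqrt ha.le).symm
    have hder : ∀ v ∈ Ioo (-d) d, HasDerivAt (fun v => Real.arcsin (v / d)) (√(a - v ^ 2))⁻¹ v := by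
      intro v hv
      have h1 : v / d ≠ -1 := by
        rw [Ne, div_eq_iff hd0.ne']; linarith [hv.1]
      have h2 : v / d ≠ 1 := by
        rw [Ne, div_eq_iff hd0.ne']; linarith [hv.2]
      have := (Real.hasDerivAt_arcsin h1 h2).comp v ((hasDerivAt_id v).div_const d)
      refine this.congr_deriv ?_
      have e : a - v ^ 2 = (1 - (v / d) ^ 2) * d ^ 2 := by rw [had]; field_simp
      rw [e, Real.sqrt_mul' _ (sq_nonneg d), Real.sqrt_sq hd0.le]
      simp [mul_comm]
    have hcont : ContinuousOn (fun v => Real.arcsin (v / d)) (Icc (-d) d) := by fun_prop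
    have hint := intervalIntegral.integrableOn_deriv_of_nonneg hcont hder (fun v _ => by positivity)
    have hz : ∀ v, v ∉ Ioc (-d) d → (√(a - v ^ 2))⁻¹ = 0 := by
      intro v hv
      have : a - v ^ 2 ≤ 0 := by
        rw [had]
        by_contra hlt
        have := abs_lt_of_sq_lt_sq (by linarith : v ^ 2 < d ^ 2) hd0.le
        rw [abs_lt] at this
        exact hv ⟨this.1, this.2.le⟩
      rw [Real.sqrt_eq_zero_of_nonpos this, inv_zero]
    constructor
    · exact hint.integrable_of_forall_notMem_eq_zero hz
    · rw [← setIntegral_eq_integral_of_forall_compl_eq_zero hz,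
        ← intervalIntegral.integral_of_le (by linarith),
        intervalIntegral.integral_eq_sub_of_hasDerivAt_of_le (by linarith) hcont hder
          ((intervalIntegrable_iff_integrableOn_Ioc_of_le (by linarith)).2 hint)]
      rw [neg_div, div_self hd0.ne']
      simp
  · have : (fun v : ℝ => (√(a - v ^ 2))⁻¹) = fun _ => 0 := by
      ext v
      rw [Real.sqrt_eq_zero_of_nonpos (by nlinarith [sq_nonneg v]), inv_zero]
    rw [this]; simp

lemma prod_int (h : ℝ → ℝ) (hc : Continuous h) (C : ℝ) (hC : ∀ t, ‖h t‖ ≤ C) :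
    Integrable (fun p : ℝ × ℝ => h p.1 * (√(1 - p.1 ^ 2 - p.2 ^ 2))⁻¹) ∧
    ∫ p : ℝ × ℝ, h p.1 * (√(1 - p.1 ^ 2 - p.2 ^ 2))⁻¹ = Real.pi * ∫ u in (-1:ℝ)..1, h u := by
  have hm : Measurable (fun p : ℝ × ℝ => (√(1 - p.1 ^ 2 - p.2 ^ 2))⁻¹) := by fun_prop
  have key : (fun u : ℝ => if 0 < 1 - u ^ 2 then Real.pi else 0) =
      (Ioo (-1:ℝ) 1).indicator (fun _ => Real.pi) := by
    ext u
    simp only [indicator, mem_Ioo, ← abs_lt, sub_pos, sq_lt_one_iff_abs_lt_one]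
  have h0 : Integrable (fun p : ℝ × ℝ => (√(1 - p.1 ^ 2 - p.2 ^ 2))⁻¹) := by
    rw [Measure.volume_eq_prod, integrable_prod_iff hm.aestronglyMeasurable]
    refine ⟨Filter.Eventually.of_forall fun u => (inner_int (1 - u ^ 2)).1, ?_⟩
    have : (fun u : ℝ => ∫ v : ℝ, ‖(√(1 - u ^ 2 - v ^ 2))⁻¹‖) =
        (Ioo (-1:ℝ) 1).indicator (fun _ => Real.pi) := by
      rw [← key]
      ext u
      rw [← (inner_int (1 - u ^ 2)).2]
      congr 1; ext v
      rw [Real.norm_of_nonneg (by positivity)]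
    rw [this, integrable_indicator_iff measurableSet_Ioo]
    simp
  have h1 : Integrable (fun p : ℝ × ℝ => h p.1 * (√(1 - p.1 ^ 2 - p.2 ^ 2))⁻¹) := by
    refine h0.bdd_mul (c := C) (by fun_prop) ?_
    exact Filter.Eventually.of_forall fun p => hC _
  refine ⟨h1, ?_⟩
  rw [Measure.volume_eq_prod] at h1 ⊢
  rw [integral_prod _ h1]
  simp only [integral_const_mul]
  simp_rw [(inner_int _).2]
  have : (fun u : ℝ => h u * if 0 < 1 - u ^ 2 then Real.pi else 0) =
      (Ioo (-1:ℝ) 1).indicator (fun u => Real.pi * h u) := by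
    ext u
    have := congrFun key u
    rw [this]
    simp only [indicator]
    split_ifs <;> ring
  rw [this, integral_indicator measurableSet_Ioo, integral_const_mul,
    intervalIntegral.integral_of_le (by norm_num), integral_Ioc_eq_integral_Ioo]

abbrev E2 := EuclideanSpace ℝ (Fin 2)

lemma coord_int (h : ℝ → ℝ) (hc : Continuous h) (C : ℝ) (hC : ∀ t, ‖h t‖ ≤ C) :
    Integrable (fun y : E2 => h (y 0) * (√(1 - ‖y‖ ^ 2))⁻¹) ∧
    ∫ y : E2, h (y 0) * (√(1 - ‖y‖ ^ 2))⁻¹ = Real.pi * ∫ u in (-1:ℝ)..1, h u := by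
  have mp := (volume_preserving_finTwoArrow ℝ).comp
    (EuclideanSpace.volume_preserving_symm_measurableEquiv_toLp (Fin 2))
  have me : MeasurableEmbedding (⇑(MeasurableEquiv.finTwoArrow (α := ℝ)) ∘
      ⇑(MeasurableEquiv.toLp 2 (Fin 2 → ℝ)).symm) :=
    (MeasurableEquiv.measurableEmbedding _).comp (MeasurableEquiv.measurableEmbedding _)
  have e : (fun y : E2 => h (y 0) * (√(1 - ‖y‖ ^ 2))⁻¹) =
      (fun p : ℝ × ℝ => h p.1 * (√(1 - p.1 ^ 2 - p.2 ^ 2))⁻¹) ∘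
       (⇑(MeasurableEquiv.finTwoArrow (α := ℝ)) ∘
      ⇑(MeasurableEquiv.toLp 2 (Fin 2 → ℝ)).symm) := by
    ext y
    simp [EuclideanSpace.real_norm_sq_eq, Fin.sum_univ_two, sub_sub]
  obtain ⟨h1, h2⟩ := prod_int h hc C hC
  constructor
  · rw [e, mp.integrable_comp_emb me]
    exact h1
  · rw [← h2, ← mp.integral_comp me]
    exact congrArg (fun f => ∫ y : E2, f y) e

lemma ridge_int (h : ℝ → ℝ) (hc : Continuous h) (C : ℝ) (hC : ∀ t, ‖h t‖ ≤ C) (x : E2) :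
    Integrable (fun y : E2 => h (inner ℝ x y) * (√(1 - ‖y‖ ^ 2))⁻¹) ∧
    ∫ y : E2, h (inner ℝ x y) * (√(1 - ‖y‖ ^ 2))⁻¹ =
      Real.pi * ∫ u in (-1:ℝ)..1, h (‖x‖ * u) := by
  obtain ⟨b, hb⟩ : ∃ b : OrthonormalBasis (Fin 2) ℝ E2, x = ‖x‖ • b 0 := by
    by_cases hx : x = 0
    · exact ⟨EuclideanSpace.basisFun _ _, by simp [hx]⟩
    · obtain ⟨b, hb⟩ := Orthonormal.exists_orthonormalBasis_extension_of_card_eq (𝕜 := ℝ) (E := E2)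
        (ι := Fin 2) (by simp) (v := fun _ => ‖x‖⁻¹ • x) (s := {0}) (by
          rw [orthonormal_iff_ite]
          intro i j
          have : i = j := Subsingleton.elim _ _
          rw [if_pos this]
          simp only [Set.domRestrict]
          rw [real_inner_smul_left, real_inner_smul_right, real_inner_self_eq_norm_sq]
          have := norm_ne_zero_iff.2 hx
          field_simp)
      refine ⟨b, ?_⟩
      rw [hb 0 rfl, smul_smul, mul_inv_cancel₀ (norm_ne_zero_iff.2 hx), one_smul]
  have mp := b.measurePreserving_repr
  have me : MeasurableEmbedding ⇑b.repr := b.repr.toHomeomorph.measurableEmbedding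
  have e : (fun y : E2 => h (inner ℝ x y) * (√(1 - ‖y‖ ^ 2))⁻¹) =
      (fun y : E2 => h (‖x‖ * y 0) * (√(1 - ‖y‖ ^ 2))⁻¹) ∘ ⇑b.repr := by
    ext y
    have : inner ℝ x y = ‖x‖ * (b.repr y) 0 := by
      rw [b.repr_apply_apply, ← real_inner_smul_left, ← hb]
    simp [this]
  obtain ⟨h1, h2⟩ := coord_int (fun u => h (‖x‖ * u)) (by fun_prop) C (fun t => hC _)
  constructor
  · rw [e, mp.integrable_comp_emb me]
    exact h1
  · rw [e, ← h2]
    exact mp.integral_comp me (fun y : E2 => h (‖x‖ * y 0) * (√(1 - ‖y‖ ^ 2))⁻¹)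

lemma char_ne {n : ℕ} (x : Fin n → E2) (hx : Function.Injective x) (b : Fin n → ℝ) (hb : b ≠ 0) :
    ∃ z : E2, ∑ i, (b i : ℂ) * Complex.exp (↑(inner ℝ (x i) z : ℝ) * Complex.I) ≠ 0 := by
  by_contra! hcon
  let χ : Fin n → (Multiplicative E2 →* ℂ) := fun i =>
    { toFun := fun z => Complex.exp (↑(inner ℝ (x i) z.toAdd : ℝ) * Complex.I)
      map_one' := by simp
      map_mul' := by
        intro u v
        rw [toAdd_mul, inner_add_right, ← Complex.exp_add]
        push_cast
        ring_nf }
  have hχ : Function.Injective χ := by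
    intro i j hij
    by_contra hne
    have hv : x i - x j ≠ 0 := sub_ne_zero.2 fun h => hne (hx h)
    set v := x i - x j with hvd
    have hn := norm_ne_zero_iff.2 hv
    have := DFunLike.congr_fun hij (Multiplicative.ofAdd ((‖v‖ ^ 2)⁻¹ • v))
    simp only [χ, MonoidHom.coe_mk, OneHom.coe_mk, toAdd_ofAdd] at this
    rw [show x i = x j + v by simp [hvd], inner_add_left] at this
    have e : inner ℝ v ((‖v‖ ^ 2)⁻¹ • v) = (1 : ℝ) := by
      rw [real_inner_smul_right, real_inner_self_eq_norm_sq]; field_simp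
    rw [e, Complex.ofReal_add, add_mul, Complex.exp_add] at this
    have h1 : Complex.exp (((1:ℝ):ℂ) * Complex.I) = 1 := by
      have h0 := Complex.exp_ne_zero (↑(inner ℝ (x j) ((‖v‖ ^ 2)⁻¹ • v) : ℝ) * Complex.I)
      exact mul_left_cancel₀ h0 (by rw [this, mul_one])
    have h2 := congrArg Complex.re h1
    rw [Complex.exp_ofReal_mul_I_re, Complex.one_re] at h2
    have := Real.cos_lt_cos_of_nonneg_of_le_pi (x := 0) (y := 1) le_rfl
      (by linarith [Real.pi_gt_three]) one_pos
    rw [Real.cos_zero] at this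
    linarith
  have li := (linearIndependent_monoidHom (Multiplicative E2) ℂ).comp χ hχ
  rw [Fintype.linearIndependent_iff] at li
  have := li (fun i => (b i : ℂ)) (by
    ext z
    have := hcon z.toAdd
    simpa [χ, Finset.sum_apply] using this)
  apply hb
  ext i
  simpa using this i

lemma maxpow (t : ℝ) : HasDerivAt (fun t : ℝ => (max t 0) ^ 4) (4 * (max t 0) ^ 3) t := by
  rcases lt_trichotomy t 0 with h | h | h
  · rw [max_eq_right h.le]
    have : (fun t : ℝ => (max t 0) ^ 4) =ᶠ[nhds t] fun _ => 0 := by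
      filter_upwards [Iio_mem_nhds h] with s hs
      rw [max_eq_right (le_of_lt hs)]; norm_num
    exact ((hasDerivAt_const t (0:ℝ)).congr_of_eventuallyEq this).congr_deriv (by norm_num)
  · subst h
    rw [hasDerivAt_iff_isLittleO]
    simp only [max_self, sub_zero, smul_eq_mul]
    norm_num
    have h2 : (fun t : ℝ => t ^ 2) =o[nhds 0] fun t => t := by
      simpa using Asymptotics.isLittleO_pow_pow (𝕜 := ℝ) (m := 1) (n := 2) (by norm_num)
    refine Asymptotics.IsBigO.trans_isLittleO ?_ h2
    refine Asymptotics.IsBigO.of_bound 1 ?_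
    filter_upwards [Icc_mem_nhds (by norm_num : (-1:ℝ) < 0) (by norm_num : (0:ℝ) < 1)] with s hs
    rw [Real.norm_of_nonneg (by positivity), Real.norm_of_nonneg (by positivity), one_mul]
    rcases max_cases s 0 with ⟨h, h'⟩ | ⟨h, h'⟩
    · rw [h]; nlinarith [hs.2, mul_nonneg (sq_nonneg s) (mul_nonneg h' (sub_nonneg.2 hs.2)), mul_nonneg (sq_nonneg s) (sub_nonneg.2 hs.2)]
    · rw [h]; nlinarith [sq_nonneg s]
  · rw [max_eq_left h.le]
    have : (fun t : ℝ => (max t 0) ^ 4) =ᶠ[nhds t] fun t => t ^ 4 := by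
      filter_upwards [Ioi_mem_nhds h] with s hs
      rw [max_eq_left (le_of_lt hs)]
    exact ((hasDerivAt_pow 4 t).congr_of_eventuallyEq this).congr_deriv (by norm_num)
lemma wend_int (r : ℝ) (hr : 0 ≤ r) :
    ∫ u in (-1:ℝ)..1, g (r * u) = 2 * ((max (1 - r) 0) ^ 4 * (4 * r + 1)) := by
  have hg := g_cont
  have hcont : Continuous fun u => g (r * u) := by fun_prop
  have h2 : ∫ v in (-1:ℝ)..0, g (r * v) = ∫ v in (0:ℝ)..1, g (r * v) := by
    have := intervalIntegral.integral_comp_neg (a := 0) (b := 1) (fun v => g (r * v))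
    simp only [mul_neg, g_neg, neg_zero] at this
    exact this.symm
  rw [← intervalIntegral.integral_add_adjacent_intervals (b := 0)
    (hcont.intervalIntegrable _ _) (hcont.intervalIntegrable _ _), h2, ← two_mul]
  congr 1
  rw [intervalIntegral.integral_eq_sub_of_hasDerivAt
    (f := fun u => u * ((max (1 - r * u) 0) ^ 4 * (4 * (r * u) + 1))) _
    (hcont.intervalIntegrable _ _)]
  · simp
  · intro u hu
    rw [uIcc_of_le zero_le_one] at hu
    have hi := hasDerivAt_id u
    have hru : HasDerivAt (fun u => r * u) r u := by simpa using hi.const_mul r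
    have hm := (maxpow (1 - r * u)).comp u (hru.const_sub 1)
    have := hi.mul (hm.mul ((hru.const_mul 4).add_const 1))
    refine this.congr_deriv ?_
    have hn : 0 ≤ r * u := mul_nonneg hr hu.1
    simp only [g, abs_of_nonneg hn, id, Function.comp]
    rcases max_cases (1 - r * u) 0 with ⟨h, _⟩ | ⟨h, _⟩
    · rw [h]; simp [h]; ring
    · rw [h]; simp [h]

lemma main_pos (c : ℝ) (hc : 0 < c) (n : ℕ) (x : Fin n → E2) (hx : Function.Injective x)
    (b : Fin n → ℝ) (hb : b ≠ 0) :
    0 < (∑ i, ∑ j, b i * b j *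
          ((max (1 - c * ‖x i - x j‖) 0) ^ 4 * (4 * c * ‖x i - x j‖ + 1))) := by
  obtain ⟨C, hC⟩ := g_cont.bounded_above_of_compact_support g_supp
  set W : E2 → ℝ := fun y => (√(1 - ‖y‖ ^ 2))⁻¹ with hW
  set q : E2 → ℝ := fun y => ∑ i, ∑ j, b i * b j * g (inner ℝ (c • x i) y - inner ℝ (c • x j) y)
    with hq
  have hr : ∀ i j, Integrable (fun y : E2 => b i * b j * (g (inner ℝ (c • (x i - x j)) y) * W y)) :=
    fun i j => (ridge_int g g_cont C hC _).1.const_mul _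
  have hqW : (fun y => q y * W y) =
      fun y => ∑ i, ∑ j, b i * b j * (g (inner ℝ (c • (x i - x j)) y) * W y) := by
    ext y
    simp only [hq, Finset.sum_mul]
    refine Finset.sum_congr rfl fun i _ => Finset.sum_congr rfl fun j _ => ?_
    rw [← inner_sub_left, ← smul_sub]; ring
  have hint : Integrable (fun y => q y * W y) := by
    rw [hqW]
    exact integrable_finsetSum _ fun i _ => integrable_finsetSum _ fun j _ => hr i j
  have hval : ∫ y, q y * W y = 2 * Real.pi * ∑ i, ∑ j, b i * b j *
          ((max (1 - c * ‖x i - x j‖) 0) ^ 4 * (4 * c * ‖x i - x j‖ + 1)) := by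
    rw [hqW, integral_finsetSum _ (fun i _ => integrable_finsetSum _ fun j _ => hr i j),
      Finset.mul_sum]
    refine Finset.sum_congr rfl fun i _ => ?_
    rw [integral_finsetSum _ (fun j _ => hr i j), Finset.mul_sum]
    refine Finset.sum_congr rfl fun j _ => ?_
    rw [integral_const_mul, (ridge_int g g_cont C hC _).2, wend_int _ (norm_nonneg _), norm_smul,
      Real.norm_of_nonneg hc.le]
    ring
  have hnn : 0 ≤ fun y => q y * W y := fun y => mul_nonneg (q_nonneg b _) (by positivity)
  have hpos : 0 < ∫ y, q y * W y := by
    rw [integral_pos_iff_support_of_nonneg hnn hint]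
    obtain ⟨z, hz⟩ := char_ne x hx b hb
    set R : ℝ := 2 * (‖z‖ + 1) with hR
    have hR0 : 0 < R := by positivity
    set y₀ : E2 := R⁻¹ • z with hy
    have hy1 : ‖y₀‖ < 1 := by
      rw [hy, norm_smul, Real.norm_of_nonneg (by positivity), inv_mul_lt_iff₀ hR0]
      linarith [norm_nonneg z]
    have hpi := Real.pi_pos
    have hq0 : 0 < q y₀ := by
      refine q_pos b _ (R / (2 * Real.pi * c)) (by positivity) ?_
      convert hz using 6 with i
      rw [hy, real_inner_smul_left, real_inner_smul_right]
      field_simp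
    have hqc : Continuous q := by
      have := g_cont
      simp only [hq]
      fun_prop
    have ho : IsOpen {y : E2 | 0 < q y ∧ ‖y‖ < 1} :=
      (isOpen_lt continuous_const hqc).inter (isOpen_lt continuous_norm continuous_const)
    refine (ho.measure_pos volume ⟨y₀, hq0, hy1⟩).trans_le (measure_mono ?_)
    rintro y ⟨h1, h2⟩
    have : 0 < 1 - ‖y‖ ^ 2 := by nlinarith [norm_nonneg y]
    have : 0 < W y := inv_pos.2 (Real.sqrt_pos.2 this)
    exact (mul_pos h1 this).ne'
  rw [hval] at hpos
  exact pos_of_mul_pos_right hpos (by have := Real.pi_pos; positivity)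

end Wend


/-- Wendland's C² function `φ_{W2}(r) = (1 - c r)₊⁴ (4 c r + 1)` is strictly
positive definite on ℝ²: for every shape parameter `c > 0`, every `n ≥ 1`, every tuple of
pairwise distinct points and every nonzero vector `b`, the quadratic form
`∑ i ∑ j, b i * b j * (1 - c ‖x i - x j‖)₊⁴ (4 c ‖x i - x j‖ + 1)` is positive;
equivalently, the matrix with these entries is positive definite. Here `(t)₊ = max t 0`. -/
theorem wendland_C2_strictly_positive_definite
    (c : ℝ) (hc : 0 < c) (n : ℕ) (hn : 1 ≤ n)
    (x : Fin n → EuclideanSpace ℝ (Fin 2)) (hx : Function.Injective x)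
    (b : Fin n → ℝ) (hb : b ≠ 0) :
    0 < (∑ i, ∑ j, b i * b j *
          ((max (1 - c * ‖x i - x j‖) 0) ^ 4 * (4 * c * ‖x i - x j‖ + 1))) ∧
      (Matrix.of fun i j =>
          (max (1 - c * ‖x i - x j‖) 0) ^ 4 * (4 * c * ‖x i - x j‖ + 1)).PosDef := by
  refine ⟨Wend.main_pos c hc n x hx b hb, ?_⟩
  refine Matrix.PosDef.of_dotProduct_mulVec_pos ?_ ?_
  · ext i j
    simp [norm_sub_rev]
  · intro v hv
    refine (Wend.main_pos c hc n x hx v hv).trans_le (le_of_eq ?_)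
    simp only [dotProduct, Matrix.mulVec, Finset.mul_sum, Matrix.of_apply, star_trivial]
    refine Finset.sum_congr rfl fun i _ => Finset.sum_congr rfl fun j _ => ?_
    ring
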